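/- There is an absolute constant C with the following property. Let k ∈ ℂ⁺, R ≥ 0, let V ∈ L∞(ℝ³) with V ≥ 0, and let μ be a bounded C² complex-valued function on {x : |x| > R} satisfying −Δμ − 2(ik − 1/|x|) ∂_rμ + V μ = 0 there (∂_rμ := x̂·∇μ), and such that |∇μ(x)| → 0 as |x| → ∞. Then for every r > R: ∫_{|x|>r} |∇μ|²/|x|² dx + ∫_{|x|>r} V |μ|²/|x|² dx ≤ C (|k|²/Im k) ( m(r) + |k|^{−1} √(m(r) m₁(r)) ), where m(r) := r^{−2} ∫_{|x|=r} |μ|² dσ_x and m₁(r) := r^{−2} ∫_{|x|=r} |∂_rμ|² dσ_x. -/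

import Mathlib

open MeasureTheory Metric Filter

noncomputable section

/-- The Laplacian of a complex-valued function on `ℝ³`. -/
def lap (u : EuclideanSpace ℝ (Fin 3) → ℂ) (x : EuclideanSpace ℝ (Fin 3)) : ℂ :=
  ∑ i : Fin 3,
    fderiv ℝ (fun y => fderiv ℝ u y (EuclideanSpace.single i 1)) x (EuclideanSpace.single i 1)

/-- The radial derivative `∂_r μ = x̂·∇μ`. -/
def rad (μ : EuclideanSpace ℝ (Fin 3) → ℂ) (x : EuclideanSpace ℝ (Fin 3)) : ℂ :=
  fderiv ℝ μ x (‖x‖⁻¹ • x)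

/-- `m(r) = r⁻² ∫_{|x|=r} |μ|² dσ`. -/
def sphAvg (μ : EuclideanSpace ℝ (Fin 3) → ℂ) (r : ℝ) : ℝ :=
  (r ^ 2)⁻¹ * ∫ x in sphere (0 : EuclideanSpace ℝ (Fin 3)) r, ‖μ x‖ ^ 2 ∂μH[2]

/-- `m₁(r) = r⁻² ∫_{|x|=r} |∂_rμ|² dσ`. -/
def sphAvg1 (μ : EuclideanSpace ℝ (Fin 3) → ℂ) (r : ℝ) : ℝ :=
  (r ^ 2)⁻¹ * ∫ x in sphere (0 : EuclideanSpace ℝ (Fin 3)) r, ‖rad μ x‖ ^ 2 ∂μH[2]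

end


abbrev E3 := EuclideanSpace ℝ (Fin 3)

open scoped ENNReal

open scoped Pointwise in
lemma cone_vol (a : E3) (ha : ‖a‖ ≤ 1) (s : Set E3) (δ : ℝ) (hδ : 0 < δ) (hδ1 : δ ≤ 1)
    (hs : s ⊆ closedBall a δ) :
    volume (Set.Ioo (0:ℝ) 1 • s) ≤ ENNReal.ofReal (24 * δ ^ 2) * volume (ball (0 : E3) 1) := by
  set n := ⌈1/δ⌉₊ with hn
  have hn1 : 1/δ ≤ n := Nat.le_ceil _
  have hn2 : (n:ℝ) < 1/δ + 1 := Nat.ceil_lt_add_one (by positivity)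
  have hnpos : (0:ℝ) < n := lt_of_lt_of_le (by positivity) hn1
  have hsub : Set.Ioo (0:ℝ) 1 • s ⊆ ⋃ j ∈ Finset.range (n+1), closedBall (((j:ℝ)/n) • a) (2*δ) := by
    rintro y ⟨t, ⟨ht0, ht1⟩, x, hx, rfl⟩
    have hx' := hs hx
    rw [mem_closedBall, dist_eq_norm] at hx'
    simp only [Set.mem_iUnion, exists_prop]
    have hf : (⌊t*n⌋₊:ℝ) ≤ t*n := Nat.floor_le (by positivity)
    have hf2 : t*n < ⌊t*n⌋₊ + 1 := Nat.lt_floor_add_one _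
    refine ⟨⌊t * n⌋₊, ?_, ?_⟩
    · rw [Finset.mem_range]
      have : (⌊t*n⌋₊:ℝ) < n + 1 := by nlinarith
      exact_mod_cast this
    · rw [mem_closedBall, dist_eq_norm]
      have e : t • x - ((⌊t*n⌋₊:ℝ)/n) • a = t • (x - a) + (t - (⌊t*n⌋₊:ℝ)/n) • a := by
        module
      have h1 : |t - (⌊t*n⌋₊:ℝ)/n| ≤ δ := by
        have : t - (⌊t*n⌋₊:ℝ)/n = (t*n - ⌊t*n⌋₊)/n := by field_simp
        rw [this, abs_of_nonneg (div_nonneg (by linarith) hnpos.le), div_le_iff₀ hnpos]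
        have := (div_le_iff₀ hδ).1 hn1
        nlinarith
      show ‖t • x - _‖ ≤ _
      rw [e]
      calc _ ≤ ‖t • (x - a)‖ + ‖(t - (⌊t*n⌋₊:ℝ)/n) • a‖ := norm_add_le _ _
        _ = t * ‖x - a‖ + |t - (⌊t*n⌋₊:ℝ)/n| * ‖a‖ := by
          rw [norm_smul, norm_smul, Real.norm_eq_abs, Real.norm_eq_abs, abs_of_pos ht0]
        _ ≤ 1 * δ + δ * 1 := by gcongr
        _ = _ := by ring
  calc _ ≤ volume (⋃ j ∈ Finset.range (n+1), closedBall (((j:ℝ)/n) • a) (2*δ)) := measure_mono hsub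
    _ ≤ ∑ j ∈ Finset.range (n+1), volume (closedBall (((j:ℝ)/n) • a) (2*δ)) :=
      measure_biUnion_finset_le _ _
    _ = ENNReal.ofReal ((n+1) * (2*δ)^3) * volume (ball (0 : E3) 1) := by
      rw [Finset.sum_congr rfl (fun j _ => Measure.addHaar_closedBall volume _ (by positivity))]
      simp only [finrank_euclideanSpace, Fintype.card_fin, Finset.sum_const, Finset.card_range, nsmul_eq_mul]
      rw [ENNReal.ofReal_mul (by positivity)]
      rw [← mul_assoc]
      congr 2
      rw [ENNReal.ofReal_add (by positivity) (by positivity)]; simp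
    _ ≤ _ := by
      refine mul_le_mul_left (ENNReal.ofReal_le_ofReal ?_) _
      have h3 : (n:ℝ) * δ < 1 + δ := by
        have := mul_lt_mul_of_pos_right hn2 hδ
        rwa [add_mul, one_div, inv_mul_cancel₀ hδ.ne', one_mul] at this
      have : ((n:ℝ)+1) * (2*δ)^3 = 8 * δ^2 * (n*δ + δ) := by ring
      rw [this]
      nlinarith [sq_nonneg δ]

noncomputable def KS : ℝ≥0∞ := 72 * volume (ball (0 : E3) 1)

lemma KS_pos : KS ≠ 0 := by
  have : volume (ball (0 : E3) 1) ≠ 0 := (measure_ball_pos _ _ one_pos).ne'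
  simp only [KS, ne_eq, mul_eq_zero, not_or]
  exact ⟨by norm_num, this⟩
lemma KS_top : KS ≠ ∞ := by
  have : volume (ball (0 : E3) 1) ≠ ∞ := measure_ball_lt_top.ne
  exact ENNReal.mul_ne_top (by norm_num) this

noncomputable abbrev sg : Measure (sphere (0 : E3) 1) := (volume : Measure E3).toSphere
noncomputable def nu (r : ℝ) : Measure E3 := Measure.map (fun ω : sphere (0 : E3) 1 => r • (ω : E3)) sg

lemma meas_sc (r : ℝ) : Measurable (fun ω : sphere (0 : E3) 1 => r • (ω : E3)) := by
  fun_prop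

lemma nu_closed (r : ℝ) (hr : 0 < r) (s : Set E3) (hs : IsClosed s) (δ : ℝ) (hδ : 0 < δ)
    (hδ1 : δ ≤ 1) (hd : ∀ x ∈ s, ∀ y ∈ s, dist x y ≤ r * δ) :
    nu r s ≤ ENNReal.ofReal (δ^2) * KS := by
  rw [nu, Measure.map_apply (meas_sc r) hs.measurableSet,
    Measure.toSphere_apply' _ (meas_sc r hs.measurableSet)]
  set A := (fun ω : sphere (0 : E3) 1 => r • (ω : E3)) ⁻¹' s
  rcases A.eq_empty_or_nonempty with h | ⟨a, ha⟩
  · rw [h]; simp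
  have := cone_vol (a : E3) (by simp) ((↑) '' A) δ hδ hδ1 (by
    rintro _ ⟨x, hx, rfl⟩
    have := hd _ hx _ ha
    simp only [dist_smul₀, Real.norm_eq_abs, abs_of_pos hr] at this
    exact le_of_mul_le_mul_left this hr)
  calc _ ≤ (3:ℝ≥0∞) * (ENNReal.ofReal (24 * δ ^ 2) * volume (ball (0 : E3) 1)) := by
        gcongr; simp
    _ = _ := by
      rw [KS, ENNReal.ofReal_mul (by norm_num)]
      rw [show ENNReal.ofReal 24 = 24 by simp]
      rw [show (72:ℝ≥0∞) = 3 * 24 by norm_num]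
      ring

lemma nu_le (r : ℝ) (hr : 0 < r) : nu r ≤ (KS * ENNReal.ofReal ((r^2)⁻¹)) • (μH[2] : Measure E3) := by
  set c := KS * ENNReal.ofReal ((r^2)⁻¹) with hc
  have c0 : c ≠ 0 := mul_ne_zero KS_pos (by simp; positivity)
  have ct : c ≠ ∞ := ENNReal.mul_ne_top KS_top (by simp)
  have key : c⁻¹ • nu r ≤ (μH[2] : Measure E3) := by
    refine Measure.le_hausdorffMeasure 2 _ (ENNReal.ofReal (r/2)) (by simp; positivity) ?_
    intro s hs
    have hD : ediam s ≠ ∞ := ne_top_of_le_ne_top (by simp) hs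
    set D := (ediam s).toReal with hDd
    have hDe : ediam s = ENNReal.ofReal D := (ENNReal.ofReal_toReal hD).symm
    have hD0 : 0 ≤ D := ENNReal.toReal_nonneg
    have hDr : D ≤ r/2 := ENNReal.toReal_le_of_le_ofReal (by positivity) hs
    have hb : ∀ δ, D/r < δ → δ ≤ 1 → nu r s ≤ ENNReal.ofReal (δ^2) * KS := by
      intro δ h1 h2
      refine (measure_mono subset_closure).trans
        (nu_closed r hr (closure s) isClosed_closure δ (lt_of_le_of_lt (by positivity) h1) h2 ?_)
      intro x hx y hy
      have h3 : edist x y ≤ ediam (closure s) := edist_le_ediam_of_mem hx hy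
      rw [ediam_closure, hDe, edist_dist] at h3
      have h4 := (ENNReal.ofReal_le_ofReal_iff hD0).1 h3
      rw [div_lt_iff₀ hr] at h1
      linarith
    have hlim : nu r s ≤ ENNReal.ofReal ((D/r)^2) * KS := by
      have ht : Tendsto (fun δ : ℝ => ENNReal.ofReal (δ^2) * KS) (nhdsWithin (D/r) (Set.Ioi (D/r)))
          (nhds (ENNReal.ofReal ((D/r)^2) * KS)) := by
        refine ENNReal.Tendsto.mul_const ?_ (Or.inr KS_top)
        refine ENNReal.tendsto_ofReal ?_
        exact ((continuous_pow 2).tendsto _).mono_left nhdsWithin_le_nhds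
      refine ge_of_tendsto ht ?_
      have : D/r < 1 := by rw [div_lt_one hr]; linarith
      filter_upwards [Ioo_mem_nhdsGT this] with δ hδ
      exact hb δ hδ.1 hδ.2.le
    rw [Measure.smul_apply, smul_eq_mul, ENNReal.inv_mul_le_iff c0 ct]
    refine hlim.trans (le_of_eq ?_)
    rw [hDe, hc, show (2:ℝ) = ((2:ℕ):ℝ) by norm_num, ENNReal.rpow_natCast, ← ENNReal.ofReal_pow hD0]
    rw [mul_assoc, ← ENNReal.ofReal_mul (by positivity), mul_comm]
    congr 2
    field_simp
  intro s
  have := key s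
  rw [Measure.smul_apply, smul_eq_mul, ENNReal.inv_mul_le_iff c0 ct] at this
  simpa using this

lemma haus_fin (r : ℝ) : (μH[2] : Measure E3) (sphere 0 r) < ∞ := by
  let p : Fin 3 → ℝ → (Fin 2 → ℝ) → E3 := fun i s y => WithLp.toLp 2 (Fin.insertNth i s y)
  let f : Fin 3 → ℝ → (Fin 2 → ℝ) → E3 := fun i s y => (r * ‖p i s y‖⁻¹) • p i s y
  have hpc : ∀ i s, ContDiff ℝ 1 (p i s) := by
    intro i s
    rw [contDiff_euclidean]
    intro j
    simp only [p]
    refine Fin.succAboveCases i ?_ ?_ j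
    · simpa using contDiff_const
    · intro m; simpa using contDiff_apply ℝ ℝ m
  have hp0 : ∀ i s y, s ≠ 0 → p i s y ≠ 0 := by
    intro i s y hs h
    have := congrArg (fun v : E3 => v i) h
    simp [p] at this
    exact hs this
  have hfc : ∀ i s, s ≠ 0 → ContDiff ℝ 1 (f i s) := by
    intro i s hs
    refine ContDiff.smul (contDiff_const.mul (ContDiff.inv ((hpc i s).norm ℝ fun y => hp0 i s y hs) ?_)) (hpc i s)
    intro y; exact norm_ne_zero_iff.2 (hp0 i s y hs)
  have hfin : ∀ i s, s ≠ 0 → (μH[2] : Measure E3) (f i s '' Set.Icc (-1) 1) < ∞ := by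
    intro i s hs
    obtain ⟨K, hK⟩ := (hfc i s hs).locallyLipschitz.locallyLipschitzOn.exists_lipschitzOnWith_of_compact
      (isCompact_Icc (a := (-1 : Fin 2 → ℝ)) (b := 1))
    refine (hK.hausdorffMeasure_image_le (by norm_num)).trans_lt ?_
    have : (μH[2] : Measure (Fin 2 → ℝ)) = volume := by
      have := hausdorffMeasure_pi_real (ι := Fin 2)
      simpa using this
    rw [this]
    exact ENNReal.mul_lt_top (by simp) isCompact_Icc.measure_lt_top
  have hsub : sphere (0:E3) r ⊆ {0} ∪ ⋃ i : Fin 3, (f i 1 '' Set.Icc (-1) 1 ∪ f i (-1) '' Set.Icc (-1) 1) := by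
    intro x hx
    have hxr : ‖x‖ = r := by simpa using hx
    by_cases hx0 : x = 0
    · left; exact hx0
    right
    obtain ⟨i, -, hi⟩ := Finset.exists_max_image Finset.univ (fun i : Fin 3 => |x i|) ⟨0, by simp⟩
    have hxi : x i ≠ 0 := by
      intro h
      apply hx0
      ext j
      have := hi j (by simp)
      rw [h, abs_zero] at this
      simpa using this
    have hmem : (fun j => x (i.succAbove j) / |x i|) ∈ Set.Icc (-1 : Fin 2 → ℝ) 1 := by
      have : ∀ j, abs (x (i.succAbove j) / abs (x i)) ≤ 1 := by
        intro j
        rw [abs_div, abs_abs]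
        exact div_le_one_of_le₀ (hi _ (by simp)) (abs_nonneg _)
      exact ⟨fun j => (abs_le.1 (this j)).1, fun j => (abs_le.1 (this j)).2⟩
    have hval : ∀ s, s = x i / |x i| → f i s (fun j => x (i.succAbove j) / |x i|) = x := by
      intro s hs
      have hpe : p i s (fun j => x (i.succAbove j) / |x i|) = |x i|⁻¹ • x := by
        ext j
        simp only [p]
        refine Fin.succAboveCases i ?_ ?_ j
        · simp [hs, div_eq_inv_mul]
        · intro m; simp [div_eq_inv_mul]
      simp only [f, hpe]
      rw [norm_smul, hxr, smul_smul]
      have hr0 : r ≠ 0 := by rw [← hxr]; exact norm_ne_zero_iff.2 hx0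
      have h2 : |x i| ≠ 0 := abs_ne_zero.2 hxi
      convert one_smul ℝ x
      simp only [norm_inv, Real.norm_eq_abs, abs_abs]
      field_simp
    refine Set.mem_iUnion.2 ⟨i, ?_⟩
    rcases lt_or_gt_of_ne hxi with h | h
    · right; exact ⟨_, hmem, hval _ (by rw [abs_of_neg h]; field_simp)⟩
    · left; exact ⟨_, hmem, hval _ (by rw [abs_of_pos h]; field_simp)⟩
  refine (measure_mono hsub).trans_lt ?_
  refine (measure_union_le _ _).trans_lt (ENNReal.add_lt_top.2 ⟨?_, ?_⟩)
  · have := Measure.hausdorffMeasure_le_one_of_subsingleton (d := 2) (Set.subsingleton_singleton (a := (0:E3))) (by norm_num)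
    exact this.trans_lt (by simp)
  · refine (measure_iUnion_le _).trans_lt ?_
    rw [tsum_fintype]
    refine ENNReal.sum_lt_top.2 fun i _ => ?_
    exact (measure_union_le _ _).trans_lt (ENNReal.add_lt_top.2 ⟨hfin i _ (by norm_num), hfin i _ (by norm_num)⟩)

lemma sph_le (r : ℝ) (hr : 0 < r) (g : E3 → ℝ) (hg : ContinuousOn g (sphere 0 r)) (h0 : ∀ x, 0 ≤ g x) :
    ∫ ω, g (r • (ω : E3)) ∂sg ≤ KS.toReal * ((r^2)⁻¹ * ∫ x in sphere (0 : E3) r, g x ∂μH[2]) := by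
  have hms : MeasurableSet (sphere (0:E3) r) := isClosed_sphere.measurableSet
  have hnu : nu r = (nu r).restrict (sphere 0 r) := by
    symm
    refine Measure.restrict_eq_self_of_ae_mem ?_
    rw [nu]
    refine (ae_map_iff (p := fun x => x ∈ sphere (0:E3) r) (meas_sc r).aemeasurable hms).2 ?_
    refine Eventually.of_forall fun ω => ?_
    simp [norm_smul, hr.le]
  have hle : nu r ≤ (KS * ENNReal.ofReal ((r^2)⁻¹)) • ((μH[2] : Measure E3).restrict (sphere 0 r)) := by
    rw [hnu, ← Measure.restrict_smul]
    exact Measure.restrict_mono le_rfl (nu_le r hr)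
  have hIntg : IntegrableOn g (sphere 0 r) (μH[2] : Measure E3) := by
    have : IsFiniteMeasure ((μH[2] : Measure E3).restrict (sphere 0 r)) := ⟨by simpa using haus_fin r⟩
    obtain ⟨C, hC⟩ := (isCompact_sphere (0:E3) r).exists_bound_of_continuousOn hg
    refine Integrable.of_bound (hg.aestronglyMeasurable hms) C ?_
    exact (ae_restrict_mem hms).mono fun x hx => hC x hx
  have hIntg2 : Integrable g ((KS * ENNReal.ofReal ((r^2)⁻¹)) • ((μH[2] : Measure E3).restrict (sphere 0 r))) :=
    Integrable.smul_measure hIntg (ENNReal.mul_ne_top KS_top (by simp))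
  have := integral_mono_measure hle (Eventually.of_forall h0) hIntg2
  rw [integral_smul_measure] at this
  rw [nu, integral_map (meas_sc r).aemeasurable (hIntg2.mono_measure hle).1] at this
  refine this.trans (le_of_eq ?_)
  rw [ENNReal.toReal_mul, ENNReal.toReal_ofReal (by positivity), smul_eq_mul, mul_assoc]

def ann (r ρ : ℝ) : Set E3 := {x | r < ‖x‖ ∧ ‖x‖ < ρ}
def cann (r ρ : ℝ) : Set E3 := {x | r ≤ ‖x‖ ∧ ‖x‖ ≤ ρ}
def ext (R : ℝ) : Set E3 := {x | R < ‖x‖}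

lemma ann_meas (r ρ : ℝ) : MeasurableSet (ann r ρ) :=
  (measurableSet_lt measurable_const measurable_norm).inter (measurableSet_lt measurable_norm measurable_const)

lemma ext_open (R : ℝ) : IsOpen (ext R) := isOpen_lt continuous_const continuous_norm

lemma cann_closed (r ρ : ℝ) : IsClosed (cann r ρ) :=
  (isClosed_le continuous_const continuous_norm).inter (isClosed_le continuous_norm continuous_const)

lemma cann_compact (r ρ : ℝ) : IsCompact (cann r ρ) := by
  refine (isCompact_closedBall (0:E3) ρ).of_isClosed_subset (cann_closed r ρ) ?_
  intro x hx
  simpa using hx.2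

lemma ann_sub (r ρ : ℝ) : ann r ρ ⊆ cann r ρ := fun _ hx => ⟨hx.1.le, hx.2.le⟩

lemma cann_sub {R r : ℝ} (ρ : ℝ) (h : R < r) : cann r ρ ⊆ ext R := fun _ hx => lt_of_lt_of_le h hx.1

lemma intOn_cann {G : Type*} [NormedAddCommGroup G] {R r : ℝ} (ρ : ℝ) (h : R < r) (f : E3 → G)
    (hf : ContinuousOn f (ext R)) : IntegrableOn f (cann r ρ) :=
  (hf.mono (cann_sub ρ h)).integrableOn_compact (cann_compact r ρ)

lemma intOn_ann {G : Type*} [NormedAddCommGroup G] {R r : ℝ} (ρ : ℝ) (h : R < r) (f : E3 → G)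
    (hf : ContinuousOn f (ext R)) : IntegrableOn f (ann r ρ) :=
  (intOn_cann ρ h f hf).mono_set (ann_sub r ρ)

lemma polar {G : Type*} [NormedAddCommGroup G] [NormedSpace ℝ G] (h : E3 → G) (hi : Integrable h) :
    ∫ x, h x = ∫ ω, (∫ s in Set.Ioi (0:ℝ), s^2 • h (s • (ω : E3))) ∂sg := by
  have hmp := (volume : Measure E3).measurePreserving_homeomorphUnitSphereProd
  have hemb := (homeomorphUnitSphereProd E3).measurableEmbedding
  have e1 : ∫ x, h x = ∫ x : ({(0:E3)}ᶜ : Set E3), h x.1 ∂((volume : Measure E3).comap Subtype.val) := by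
    rw [integral_subtype_comap (measurableSet_singleton _).compl fun x ↦ h x,
        restrict_compl_singleton]
  have hpt : ∀ x : ({(0:E3)}ᶜ : Set E3), h x.1 =
      (fun p : sphere (0:E3) 1 × Set.Ioi (0:ℝ) => h (p.2.1 • p.1.1)) (homeomorphUnitSphereProd E3 x) := by
    intro x
    have hx : ‖x.1‖ ≠ 0 := norm_ne_zero_iff.2 x.2
    simp [smul_smul, hx]
  have e2 : ∫ x : ({(0:E3)}ᶜ : Set E3), h x.1 ∂((volume : Measure E3).comap Subtype.val) =
      ∫ p : sphere (0:E3) 1 × Set.Ioi (0:ℝ), h (p.2.1 • p.1.1)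
        ∂((volume : Measure E3).toSphere.prod (.volumeIoiPow (Module.finrank ℝ E3 - 1))) := by
    simp_rw [hpt]
    exact hmp.integral_comp hemb (fun p : sphere (0:E3) 1 × Set.Ioi (0:ℝ) => h (p.2.1 • p.1.1))
  have hIntg : Integrable (fun p : sphere (0:E3) 1 × Set.Ioi (0:ℝ) => h (p.2.1 • p.1.1))
      ((volume : Measure E3).toSphere.prod (.volumeIoiPow (Module.finrank ℝ E3 - 1))) := by
    rw [← hmp.integrable_comp_emb hemb]
    have : (fun p : sphere (0:E3) 1 × Set.Ioi (0:ℝ) => h (p.2.1 • p.1.1)) ∘ homeomorphUnitSphereProd E3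
      = fun x => h x.1 := by
      ext x; exact (hpt x).symm
    rw [this]
    exact (integrableOn_iff_comap_subtypeVal (by measurability)).1 hi.integrableOn
  rw [e1, e2, integral_prod _ hIntg]
  congr 1
  ext ω
  simp only [Measure.volumeIoiPow, ENNReal.ofReal]
  rw [integral_withDensity_eq_integral_smul]
  · rw [integral_subtype_comap measurableSet_Ioi fun a : ℝ ↦ Real.toNNReal (a ^ (Module.finrank ℝ E3 - 1)) • h (a • (ω:E3))]
    refine setIntegral_congr_fun measurableSet_Ioi fun x hx ↦ ?_
    simp only [NNReal.smul_def]
    rw [Real.coe_toNNReal _ (pow_nonneg hx.out.le _)]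
    simp
  · exact (measurable_subtype_coe.pow_const _).real_toNNReal

lemma polar_ann {G : Type*} [NormedAddCommGroup G] [NormedSpace ℝ G] (h : E3 → G) {r ρ : ℝ} (hr : 0 < r)
    (hi : IntegrableOn h (ann r ρ)) :
    ∫ x in ann r ρ, h x = ∫ ω, (∫ s in Set.Ioo r ρ, s^2 • h (s • (ω : E3))) ∂sg := by
  rw [← integral_indicator (ann_meas r ρ), polar _ ((integrable_indicator_iff (ann_meas r ρ)).2 hi)]
  congr 1
  ext ω
  have hsub : Set.Ioo r ρ ⊆ Set.Ioi 0 := fun s hs => hr.trans hs.1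
  rw [← integral_indicator measurableSet_Ioo, ← integral_indicator measurableSet_Ioi]
  congr 1
  ext s
  by_cases hs : 0 < s
  · rw [Set.indicator_of_mem (show s ∈ Set.Ioi 0 from hs)]
    have hn : ‖s • (ω:E3)‖ = s := by simp [norm_smul, hs.le]
    by_cases h2 : s ∈ Set.Ioo r ρ
    · rw [Set.indicator_of_mem h2, Set.indicator_of_mem]
      simpa [ann, hn] using h2
    · rw [Set.indicator_of_notMem h2, Set.indicator_of_notMem, smul_zero]
      simpa [ann, hn] using h2
  · rw [Set.indicator_of_notMem (show s ∉ Set.Ioi 0 from hs), Set.indicator_of_notMem]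
    intro h2; exact hs (hsub h2)

lemma lemP {G : Type*} [NormedAddCommGroup G] [NormedSpace ℝ G] [CompleteSpace G] (f : E3 → G) {R r ρ : ℝ}
    (hR : 0 ≤ R) (hr : R < r) (hρ : r < ρ) (hf : ContDiffOn ℝ 1 f (ext R)) :
    ∫ x in ann r ρ, (‖x‖^3)⁻¹ • fderiv ℝ f x x = ∫ ω, (f (ρ • (ω : E3)) - f (r • (ω : E3))) ∂sg := by
  have hr0 : 0 < r := hR.trans_lt hr
  have hc : ContinuousOn (fderiv ℝ f) (ext R) := hf.continuousOn_fderiv_of_isOpen (ext_open R) le_rfl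
  have hcont : ContinuousOn (fun x => (‖x‖^3)⁻¹ • fderiv ℝ f x x) (ext R) := by
    refine ContinuousOn.smul (ContinuousOn.inv₀ (by fun_prop) ?_) (hc.clm_apply continuousOn_id)
    intro x hx
    have : 0 < ‖x‖ := hR.trans_lt hx
    positivity
  rw [polar_ann _ hr0 (intOn_ann ρ hr _ hcont)]
  congr 1
  ext ω
  have hn : ∀ s : ℝ, 0 < s → ‖s • (ω:E3)‖ = s := by intro s hs; simp [norm_smul, hs.le]
  have hd : ∀ s ∈ Set.Icc r ρ, HasDerivAt (fun s : ℝ => f (s • (ω:E3))) (fderiv ℝ f (s • (ω:E3)) ω) s := by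
    intro s hs
    have hs0 : 0 < s := hr0.trans_le hs.1
    have hmem : s • (ω:E3) ∈ ext R := by
      show R < _
      rw [hn s hs0]; exact hr.trans_le hs.1
    have h1 : HasFDerivAt f (fderiv ℝ f (s • (ω:E3))) (s • (ω:E3)) :=
      ((hf.differentiableOn one_ne_zero).differentiableAt ((ext_open R).mem_nhds hmem)).hasFDerivAt
    have h2 : HasDerivAt (fun s : ℝ => s • (ω:E3)) ((1:ℝ) • (ω:E3)) s := (hasDerivAt_id s).smul_const _
    rw [one_smul] at h2
    exact h1.comp_hasDerivAt s h2
  have hco : ContinuousOn (fun s : ℝ => fderiv ℝ f (s • (ω:E3)) ω) (Set.Icc r ρ) := by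
    refine ContinuousOn.clm_apply (hc.comp (by fun_prop) ?_) continuousOn_const
    intro s hs
    show R < _
    rw [hn s (hr0.trans_le hs.1)]; exact hr.trans_le hs.1
  have hftc := intervalIntegral.integral_eq_sub_of_hasDerivAt (a := r) (b := ρ)
    (f := fun s : ℝ => f (s • (ω:E3))) (f' := fun s => fderiv ℝ f (s • (ω:E3)) ω)
    (by rw [Set.uIcc_of_le hρ.le]; exact hd) (by
      refine ContinuousOn.intervalIntegrable ?_
      rw [Set.uIcc_of_le hρ.le]; exact hco)
  rw [← hftc, intervalIntegral.integral_of_le hρ.le, integral_Ioc_eq_integral_Ioo]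
  refine setIntegral_congr_fun measurableSet_Ioo fun s hs => ?_
  have hs0 : 0 < s := hr0.trans hs.1
  simp only [hn s hs0, map_smul, smul_smul]
  convert one_smul ℝ _
  field_simp

noncomputable def cut (r ρ : ℝ) (n : ℕ) (t : ℝ) : ℝ :=
  Real.smoothTransition (n * (t - r^2)) * Real.smoothTransition (n * (ρ^2 - t))

lemma cut_contDiff (r ρ : ℝ) (n : ℕ) : ContDiff ℝ 1 (cut r ρ n) := by
  unfold cut
  exact (Real.smoothTransition.contDiff.comp (by fun_prop)).mul
    (Real.smoothTransition.contDiff.comp (by fun_prop))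

lemma cut_zero {r ρ : ℝ} (hr : 0 < r) (hρ : r < ρ) (n : ℕ) (x : E3) (hx : x ∉ ann r ρ) :
    cut r ρ n (‖x‖^2) = 0 := by
  unfold cut
  by_cases h : r < ‖x‖
  · have h2 : ρ ≤ ‖x‖ := by
      by_contra h3
      exact hx ⟨h, not_le.1 h3⟩
    rw [Real.smoothTransition.zero_of_nonpos (x := n * (ρ^2 - ‖x‖^2)), mul_zero]
    have : ρ^2 ≤ ‖x‖^2 := by have := hr.trans hρ; gcongr
    exact mul_nonpos_of_nonneg_of_nonpos (by positivity) (by linarith)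
  · rw [Real.smoothTransition.zero_of_nonpos (x := n * (‖x‖^2 - r^2)), zero_mul]
    have : ‖x‖^2 ≤ r^2 := by have := not_lt.1 h; gcongr
    exact mul_nonpos_of_nonneg_of_nonpos (by positivity) (by linarith)

lemma cut_one {r ρ : ℝ} (hr : 0 < r) (x : E3) (hx : x ∈ ann r ρ) :
    ∀ᶠ n : ℕ in atTop, cut r ρ n (‖x‖^2) = 1 := by
  have h1 : 0 < ‖x‖^2 - r^2 := by have := hx.1; have : r^2 < ‖x‖^2 := by gcongr
                                  linarith
  have h2 : 0 < ρ^2 - ‖x‖^2 := by have := hx.2; have : ‖x‖^2 < ρ^2 := by gcongr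
                                  linarith
  have t1 : Tendsto (fun n : ℕ => (n:ℝ) * (‖x‖^2 - r^2)) atTop atTop :=
    tendsto_natCast_atTop_atTop.atTop_mul_const h1
  have t2 : Tendsto (fun n : ℕ => (n:ℝ) * (ρ^2 - ‖x‖^2)) atTop atTop :=
    tendsto_natCast_atTop_atTop.atTop_mul_const h2
  filter_upwards [t1.eventually_ge_atTop 1, t2.eventually_ge_atTop 1] with n a b
  unfold cut
  rw [Real.smoothTransition.one_of_one_le a, Real.smoothTransition.one_of_one_le b, one_mul]

lemma cut_le (r ρ : ℝ) (n : ℕ) (t : ℝ) : ‖cut r ρ n t‖ ≤ 1 := by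
  unfold cut
  rw [norm_mul, Real.norm_eq_abs, Real.norm_eq_abs, abs_of_nonneg (Real.smoothTransition.nonneg _),
    abs_of_nonneg (Real.smoothTransition.nonneg _)]
  exact mul_le_one₀ (Real.smoothTransition.le_one _) (Real.smoothTransition.nonneg _) (Real.smoothTransition.le_one _)

lemma lemT0 (F : Fin 3 → E3 → ℂ) {R r ρ : ℝ}
    (hR : 0 ≤ R) (hr : R < r) (hρ : r < ρ) (hF : ∀ i, ContDiffOn ℝ 1 (F i) (ext R))
    (h0 : ∀ x ∈ ext R, ∑ i, (x i : ℝ) • F i x = 0) (n : ℕ) :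
    ∫ x, cut r ρ n (‖x‖^2) • ∑ i, fderiv ℝ (F i) x (EuclideanSpace.single i 1) = 0 := by
  have hr0 : 0 < r := hR.trans_lt hr
  set η : E3 → ℝ := fun x => cut r ρ n (‖x‖^2) with hη
  have hηc : ContDiff ℝ 1 η := (cut_contDiff r ρ n).comp (contDiff_norm_sq ℝ)
  have hsupp : tsupport η ⊆ cann r ρ := by
    refine closure_minimal ?_ (cann_closed r ρ)
    intro x hx
    by_contra h
    exact hx (cut_zero hr0 hρ n x (fun h' => h (ann_sub _ _ h')))
  have hz : ∀ x ∉ cann r ρ, η x = 0 := fun x hx => image_eq_zero_of_notMem_tsupport fun h => hx (hsupp h)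
  have hdz : ∀ x ∉ cann r ρ, fderiv ℝ η x = 0 := fun x hx => by
    by_contra h
    exact hx (hsupp (support_fderiv_subset ℝ h))
  have hdη : ∀ x (i : Fin 3), fderiv ℝ η x (EuclideanSpace.single i 1) = deriv (cut r ρ n) (‖x‖^2) * (2 * x i) := by
    intro x i
    have h1 : HasFDerivAt (fun x : E3 => ‖x‖^2) (2 • innerSL ℝ x) x := (hasStrictFDerivAt_norm_sq x).hasFDerivAt
    have h2 : HasDerivAt (cut r ρ n) (deriv (cut r ρ n) (‖x‖^2)) (‖x‖^2) :=
      (((cut_contDiff r ρ n).differentiable one_ne_zero) _).hasDerivAt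
    have h3 := h2.comp_hasFDerivAt x h1
    rw [show η = cut r ρ n ∘ fun x : E3 => ‖x‖^2 from rfl, h3.fderiv]
    simp [EuclideanSpace.inner_single_right]
  have hcd : ∀ i, ContinuousOn (fun x => fderiv ℝ (F i) x (EuclideanSpace.single i 1)) (ext R) := fun i =>
    ((hF i).continuousOn_fderiv_of_isOpen (ext_open R) le_rfl).clm_apply continuousOn_const
  have hcη : ∀ i : Fin 3, Continuous (fun x => fderiv ℝ η x (EuclideanSpace.single i 1)) := fun i =>
    (hηc.continuous_fderiv one_ne_zero).clm_apply continuous_const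
  have hIntg : ∀ g : E3 → ℂ, ContinuousOn g (ext R) → (∀ x ∉ cann r ρ, g x = 0) → Integrable g := by
    intro g hg hg0
    rw [← integrableOn_iff_integrable_of_support_subset (s := cann r ρ)]
    · exact intOn_cann ρ hr g hg
    · intro x hx; by_contra h; exact hx (hg0 x h)
  have i1 : ∀ i, Integrable (fun x => η x • fderiv ℝ (F i) x (EuclideanSpace.single i 1)) := fun i =>
    hIntg _ (hηc.continuous.continuousOn.smul (hcd i)) (fun x hx => by simp [hz x hx])
  have i2 : ∀ i, Integrable (fun x => fderiv ℝ η x (EuclideanSpace.single i 1) • F i x) := fun i =>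
    hIntg _ ((hcη i).continuousOn.smul (hF i).continuousOn) (fun x hx => by simp [hdz x hx])
  have i3 : ∀ i, Integrable (fun x => η x • F i x) := fun i =>
    hIntg _ (hηc.continuous.continuousOn.smul (hF i).continuousOn) (fun x hx => by simp [hz x hx])
  have ibp : ∀ i, ∫ x, η x • fderiv ℝ (F i) x (EuclideanSpace.single i 1) =
      - ∫ x, fderiv ℝ η x (EuclideanSpace.single i 1) • F i x := fun i =>
    integral_smul_fderiv_eq_neg_fderiv_smul_of_integrable (i2 i) (i1 i) (i3 i)
      (fun x _ => (hηc.differentiable one_ne_zero) x)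
      (fun x hx => ((hF i).differentiableOn one_ne_zero).differentiableAt
        ((ext_open R).mem_nhds (cann_sub ρ hr (hsupp hx))))
  simp_rw [Finset.smul_sum]
  rw [integral_finsetSum _ (fun i _ => i1 i)]
  simp_rw [ibp]
  rw [Finset.sum_neg_distrib, ← integral_finsetSum _ (fun i _ => i2 i), neg_eq_zero]
  refine integral_eq_zero_of_ae (Eventually.of_forall fun x => ?_)
  by_cases hx : x ∈ cann r ρ
  · have := h0 x (cann_sub ρ hr hx)
    simp only [hdη, Pi.zero_apply]
    calc _ = ∑ i, (deriv (cut r ρ n) (‖x‖^2) * 2) • ((x i : ℝ) • F i x) := by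
          refine Finset.sum_congr rfl fun i _ => ?_
          rw [smul_smul, mul_assoc]
      _ = 0 := by rw [← Finset.smul_sum, this, smul_zero]
  · simp [hdz x hx]

lemma lemT (F : Fin 3 → E3 → ℂ) {R r ρ : ℝ}
    (hR : 0 ≤ R) (hr : R < r) (hρ : r < ρ) (hF : ∀ i, ContDiffOn ℝ 1 (F i) (ext R))
    (h0 : ∀ x ∈ ext R, ∑ i, (x i : ℝ) • F i x = 0) :
    ∫ x in ann r ρ, ∑ i, fderiv ℝ (F i) x (EuclideanSpace.single i 1) = 0 := by
  have hr0 : 0 < r := hR.trans_lt hr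
  have hcd : ContinuousOn (fun x => ∑ i, fderiv ℝ (F i) x (EuclideanSpace.single i 1)) (ext R) :=
    continuousOn_finsetSum _ fun i _ =>
    ((hF i).continuousOn_fderiv_of_isOpen (ext_open R) le_rfl).clm_apply continuousOn_const
  set g := fun x => ∑ i, fderiv ℝ (F i) x (EuclideanSpace.single i 1) with hg
  have hgi : Integrable ((ann r ρ).indicator g) :=
    (integrable_indicator_iff (ann_meas r ρ)).2 (intOn_ann ρ hr g hcd)
  have heq : ∀ n : ℕ, (fun x => cut r ρ n (‖x‖^2) • g x) = fun x => cut r ρ n (‖x‖^2) • (ann r ρ).indicator g x := by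
    intro n
    ext x
    by_cases hx : x ∈ ann r ρ
    · rw [Set.indicator_of_mem hx]
    · rw [cut_zero hr0 hρ n x hx, zero_smul, zero_smul]
  have ht : Tendsto (fun n : ℕ => ∫ x, cut r ρ n (‖x‖^2) • g x) atTop (nhds (∫ x, (ann r ρ).indicator g x)) := by
    simp_rw [heq]
    refine tendsto_integral_of_dominated_convergence (fun x => ‖(ann r ρ).indicator g x‖) ?_ hgi.norm ?_ ?_
    · intro n
      have hm : AEStronglyMeasurable (fun x : E3 => cut r ρ n (‖x‖^2)) volume :=
        ((cut_contDiff r ρ n).continuous.comp (by fun_prop)).aestronglyMeasurable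
      exact AEStronglyMeasurable.smul hm hgi.1
    · intro n
      refine Eventually.of_forall fun x => ?_
      rw [norm_smul]
      exact mul_le_of_le_one_left (norm_nonneg _) (cut_le _ _ _ _)
    · refine Eventually.of_forall fun x => ?_
      by_cases hx : x ∈ ann r ρ
      · refine tendsto_const_nhds.congr' ?_
        filter_upwards [cut_one hr0 x hx] with n hn
        rw [hn, one_smul]
      · simp [Set.indicator_of_notMem hx]
  simp_rw [hg, lemT0 F hR hr hρ hF h0] at ht
  rw [← integral_indicator (ann_meas r ρ)]
  exact (tendsto_nhds_unique ht tendsto_const_nhds)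

noncomputable def bas (i : Fin 3) : E3 := EuclideanSpace.single i 1
noncomputable def conju (u : E3 → ℂ) (x : E3) : ℂ := (starRingEnd ℂ) (u x)
noncomputable def ww (u : E3 → ℂ) (x : E3) : ℂ := conju u x * fderiv ℝ u x x
noncomputable def qq (x : E3) : ℝ := (‖x‖^2)⁻¹
noncomputable def pd (u : E3 → ℂ) (i : Fin 3) (x : E3) : ℂ := fderiv ℝ u x (bas i)
noncomputable def FF (u : E3 → ℂ) (i : Fin 3) (x : E3) : ℂ :=
  qq x • (conju u x * pd u i x) - (qq x * qq x * x i) • ww u x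
noncomputable def bb (u : E3 → ℂ) (x : E3) : ℂ := ‖x‖⁻¹ • ww u x

lemma sum_bas (x : E3) : x = ∑ i, (x i) • bas i := by
  ext j
  fin_cases j <;> simp [bas, Fin.sum_univ_three]

lemma clm_sum {G : Type*} [NormedAddCommGroup G] [NormedSpace ℝ G] (L : E3 →L[ℝ] G) (x : E3) :
    L x = ∑ i, (x i) • L (bas i) := by
  conv_lhs => rw [sum_bas x]
  rw [map_sum]
  simp only [map_smul]

lemma nsq (x : E3) : ‖x‖^2 = x 0 ^ 2 + x 1 ^ 2 + x 2 ^ 2 := by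
  rw [EuclideanSpace.norm_sq_eq, Fin.sum_univ_three]; simp

section
variable {u : E3 → ℂ} {R : ℝ}

lemma cd_u1 (hu : ContDiffOn ℝ 2 u (ext R)) : ContDiffOn ℝ 1 u (ext R) := hu.of_le (by norm_num)

lemma cd_fd (hu : ContDiffOn ℝ 2 u (ext R)) : ContDiffOn ℝ 1 (fderiv ℝ u) (ext R) :=
  hu.fderiv_of_isOpen (ext_open R) (by norm_num)

lemma cd_conj (hu : ContDiffOn ℝ 2 u (ext R)) : ContDiffOn ℝ 1 (conju u) (ext R) :=
  Complex.conjCLE.contDiff.comp_contDiffOn (cd_u1 hu)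

lemma cd_pd (hu : ContDiffOn ℝ 2 u (ext R)) (i : Fin 3) : ContDiffOn ℝ 1 (pd u i) (ext R) :=
  (cd_fd hu).clm_apply contDiffOn_const

lemma cd_ww (hu : ContDiffOn ℝ 2 u (ext R)) : ContDiffOn ℝ 1 (ww u) (ext R) :=
  (cd_conj hu).mul ((cd_fd hu).clm_apply contDiffOn_id)

lemma npos (hR : 0 ≤ R) {x : E3} (hx : x ∈ ext R) : 0 < ‖x‖ := hR.trans_lt hx

lemma cd_qq (hR : 0 ≤ R) : ContDiffOn ℝ 1 qq (ext R) := by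
  refine ContDiffOn.inv (contDiff_norm_sq ℝ).contDiffOn ?_
  intro x hx
  have := npos hR hx
  positivity

lemma cd_ninv (hR : 0 ≤ R) : ContDiffOn ℝ 1 (fun x : E3 => ‖x‖⁻¹) (ext R) := by
  refine ContDiffOn.inv (contDiffOn_id.norm ℝ ?_) ?_
  · intro x hx; exact norm_pos_iff.1 (npos hR hx)
  · intro x hx; exact (npos hR hx).ne'

lemma cd_FF (hR : 0 ≤ R) (hu : ContDiffOn ℝ 2 u (ext R)) (i : Fin 3) : ContDiffOn ℝ 1 (FF u i) (ext R) := by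
  have hp : ContDiffOn ℝ 1 (fun x : E3 => x i) (ext R) :=
    (EuclideanSpace.proj (𝕜 := ℝ) i : E3 →L[ℝ] ℝ).contDiff.contDiffOn
  exact ContDiffOn.sub ((cd_qq hR).smul ((cd_conj hu).mul (cd_pd hu i)))
    ((((cd_qq hR).mul (cd_qq hR)).mul hp).smul (cd_ww hu))

lemma cd_bb (hR : 0 ≤ R) (hu : ContDiffOn ℝ 2 u (ext R)) : ContDiffOn ℝ 1 (bb u) (ext R) :=
  (cd_ninv hR).smul (cd_ww hu)

lemma tang (hR : 0 ≤ R) : ∀ x ∈ ext R, ∑ i, (x i : ℝ) • FF u i x = 0 := by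
  intro x hx
  have hp := npos hR hx
  have h2 : ww u x = conju u x * ∑ i, (x i) • pd u i x := by
    rw [ww, clm_sum]; rfl
  have hq : qq x * (x 0 ^ 2 + x 1 ^ 2 + x 2 ^ 2) = 1 := by
    rw [← nsq, qq]; field_simp
  have hq' : (qq x : ℂ) * ((x 0:ℂ) ^ 2 + (x 1 : ℂ) ^ 2 + (x 2:ℂ) ^ 2) = 1 := by exact_mod_cast hq
  simp only [FF, h2, Fin.sum_univ_three, Complex.real_smul, Complex.ofReal_mul]
  linear_combination (-(conju u x * qq x * (x 0 * pd u 0 x + x 1 * pd u 1 x + x 2 * pd u 2 x))) * hq'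

lemma hasF {f : E3 → ℂ} (hf : ContDiffOn ℝ 1 f (ext R)) {x : E3} (hx : x ∈ ext R) :
    HasFDerivAt f (fderiv ℝ f x) x :=
  ((hf.differentiableOn one_ne_zero).differentiableAt ((ext_open R).mem_nhds hx)).hasFDerivAt

lemma has_conj (hu : ContDiffOn ℝ 2 u (ext R)) {x : E3} (hx : x ∈ ext R) (v : E3) :
    fderiv ℝ (conju u) x v = (starRingEnd ℂ) (fderiv ℝ u x v) := by
  have h := (Complex.conjCLE.toContinuousLinearMap.hasFDerivAt (x := u x)).comp x (hasF (cd_u1 hu) hx)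
  have h' : HasFDerivAt (conju u) _ x := h
  rw [h'.fderiv]
  simp

lemma has_qq (hR : 0 ≤ R) {x : E3} (hx : x ∈ ext R) :
    HasFDerivAt qq ((-(qq x)^2) • ((2:ℝ) • innerSL ℝ x)) x := by
  have hp := npos hR hx
  have h1 : HasFDerivAt (fun x : E3 => ‖x‖^2) (2 • innerSL ℝ x) x := (hasStrictFDerivAt_norm_sq x).hasFDerivAt
  have h2 := (hasDerivAt_inv (x := ‖x‖^2) (by positivity)).comp_hasFDerivAt x h1
  have h3 : HasFDerivAt qq _ x := h2
  have e : (-(qq x)^2) • ((2:ℝ) • innerSL ℝ x) = -((‖x‖ ^ 2) ^ 2)⁻¹ • 2 • (innerSL ℝ) x := by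
    ext v
    simp [qq]
  rw [e]
  exact h3

lemma div_FF (hR : 0 ≤ R) (hu : ContDiffOn ℝ 2 u (ext R)) {x : E3} (hx : x ∈ ext R) :
    ∑ i, fderiv ℝ (FF u i) x (EuclideanSpace.single i 1) =
      qq x * (∑ i, (starRingEnd ℂ) (pd u i x) * pd u i x + conju u x * lap u x)
        - 2 * (qq x)^2 * ww u x - (qq x)^2 * (fderiv ℝ (ww u) x x - ww u x) := by
  have hp := npos hR hx
  have key : ∀ i, fderiv ℝ (FF u i) x (bas i) =
     (qq x : ℂ) * (conju u x * fderiv ℝ (pd u i) x (bas i) + (starRingEnd ℂ) (pd u i x) * pd u i x)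
      + (-(qq x)^2 * (2 * x i)) * (conju u x * pd u i x)
      - ((qq x * qq x * x i) * fderiv ℝ (ww u) x (bas i) +
        (2 * qq x * (-(qq x)^2 * (2 * x i)) * x i + qq x * qq x) * ww u x) := by
    intro i
    have hq := has_qq hR hx
    have hxi : HasFDerivAt (fun y : E3 => y i) (EuclideanSpace.proj (𝕜 := ℝ) i : E3 →L[ℝ] ℝ) x :=
      (EuclideanSpace.proj (𝕜 := ℝ) i : E3 →L[ℝ] ℝ).hasFDerivAt
    have h := (hq.smul ((hasF (cd_conj hu) hx).mul (hasF (cd_pd hu i) hx))).sub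
      (((hq.mul hq).mul hxi).smul (hasF (cd_ww hu) hx))
    have h' : HasFDerivAt (FF u i) _ x := h
    rw [h'.fderiv]
    have hb : (bas i) i = 1 := by simp [bas]
    have hin : inner ℝ x (bas i) = x i := by simp [bas, EuclideanSpace.inner_single_right]
    simp [has_conj hu hx, hb, hin]
    simp only [pd]
    ring
  have hlap : lap u x = ∑ i, fderiv ℝ (pd u i) x (bas i) := rfl
  have hwx : ww u x = conju u x * ∑ i, (x i) • pd u i x := by rw [ww, clm_sum]; rfl
  have hq : qq x * (x 0 ^ 2 + x 1 ^ 2 + x 2 ^ 2) = 1 := by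
    rw [← nsq, qq]; field_simp
  have hq' : (qq x : ℂ) * ((x 0:ℂ) ^ 2 + (x 1 : ℂ) ^ 2 + (x 2:ℂ) ^ 2) = 1 := by exact_mod_cast hq
  change ∑ i, fderiv ℝ (FF u i) x (bas i) = _
  rw [clm_sum (fderiv ℝ (ww u) x) x, hlap]
  simp only [key, Fin.sum_univ_three, Complex.real_smul] at hwx ⊢
  linear_combination (2 * (qq x:ℂ)^2) * hwx + (4 * (qq x : ℂ)^2 * ww u x) * hq'

lemma fd_bb (hR : 0 ≤ R) (hu : ContDiffOn ℝ 2 u (ext R)) {x : E3} (hx : x ∈ ext R) :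
    (‖x‖^3)⁻¹ • fderiv ℝ (bb u) x x = (qq x : ℂ)^2 * (fderiv ℝ (ww u) x x - ww u x) := by
  have hp := npos hR hx
  have h0 : x ≠ 0 := norm_pos_iff.1 hp
  have h1 : HasFDerivAt (fun x : E3 => ‖x‖⁻¹) (fderiv ℝ (fun x : E3 => ‖x‖⁻¹) x) x :=
    (((cd_ninv hR).differentiableOn one_ne_zero).differentiableAt ((ext_open R).mem_nhds hx)).hasFDerivAt
  have hray : fderiv ℝ (fun x : E3 => ‖x‖⁻¹) x x = - ‖x‖⁻¹ := by
    have h2 : HasDerivAt (fun t : ℝ => t • x) ((1:ℝ) • x) 1 := (hasDerivAt_id (1:ℝ)).smul_const x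
    rw [one_smul] at h2
    have h1' : HasFDerivAt (fun x : E3 => ‖x‖⁻¹) (fderiv ℝ (fun x : E3 => ‖x‖⁻¹) x) ((1:ℝ) • x) := by
      rwa [one_smul]
    have h3 := h1'.comp_hasDerivAt (1:ℝ) h2
    have h4 : HasDerivAt (fun t : ℝ => t⁻¹ * ‖x‖⁻¹) (-((1:ℝ)^2)⁻¹ * ‖x‖⁻¹) 1 :=
      (hasDerivAt_inv one_ne_zero).mul_const _
    have h5 : (fun t : ℝ => t⁻¹ * ‖x‖⁻¹) =ᶠ[nhds 1] ((fun x : E3 => ‖x‖⁻¹) ∘ fun t : ℝ => t • x) := by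
      filter_upwards [lt_mem_nhds (zero_lt_one (α := ℝ))] with t ht
      simp [norm_smul, abs_of_pos ht, mul_comm]
    have := (h3.congr_of_eventuallyEq h5).unique h4
    simpa using this
  have h' : HasFDerivAt (bb u) _ x := h1.smul (hasF (cd_ww hu) hx)
  rw [h'.fderiv]
  simp [hray, qq]
  have : (‖x‖:ℂ) ≠ 0 := by exact_mod_cast hp.ne'
  field_simp
  ring

lemma fd_nsq (hu : ContDiffOn ℝ 2 u (ext R)) {x : E3} (hx : x ∈ ext R) :
    fderiv ℝ (fun y => ‖u y‖^2) x x = 2 * (ww u x).re := by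
  have h := (hasF (cd_u1 hu) hx).norm_sq
  rw [h.fderiv]
  simp [ww, conju, Complex.inner]
  ring
end

lemma opn (L : E3 →L[ℝ] ℂ) : ‖L‖^2 ≤ ∑ i, ‖L (bas i)‖^2 := by
  have h : ‖L‖ ≤ Real.sqrt (∑ i, ‖L (bas i)‖^2) := by
    refine L.opNorm_le_bound (Real.sqrt_nonneg _) fun x => ?_
    rw [clm_sum L x]
    calc ‖∑ i, (x i) • L (bas i)‖ ≤ ∑ i, ‖x i‖ * ‖L (bas i)‖ := by
          refine (norm_sum_le _ _).trans (le_of_eq ?_)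
          simp only [norm_smul]
      _ ≤ Real.sqrt (∑ i, ‖x i‖^2) * Real.sqrt (∑ i, ‖L (bas i)‖^2) :=
          Real.sum_mul_le_sqrt_mul_sqrt _ _ _
      _ = _ := by rw [mul_comm, ← EuclideanSpace.norm_eq]
  calc ‖L‖^2 ≤ (Real.sqrt (∑ i, ‖L (bas i)‖^2))^2 := by gcongr
    _ = _ := Real.sq_sqrt (by positivity)

noncomputable def gg (V : E3 → ℝ) (u : E3 → ℂ) (x : E3) : ℝ :=
  qq x * (∑ i, ‖pd u i x‖^2 + V x * ‖u x‖^2)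

section
variable {u : E3 → ℂ} {R : ℝ} {V : E3 → ℝ} {k : ℂ}

lemma rad_eq (x : E3) : rad u x = ‖x‖⁻¹ • fderiv ℝ u x x := by
  rw [rad, map_smul]

lemma bb_eq (x : E3) : bb u x = conju u x * rad u x := by
  rw [rad_eq, bb, ww]; simp only [Complex.real_smul]; ring

lemma pointwise (hR : 0 ≤ R) (hu : ContDiffOn ℝ 2 u (ext R)) {x : E3} (hx : x ∈ ext R)
    (hpde : -(lap u x) - 2 * (Complex.I * k - ((‖x‖⁻¹ : ℝ) : ℂ)) * rad u x
                  + (V x : ℂ) * u x = 0) :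
    ((gg V u x : ℝ) : ℂ) = ∑ i, fderiv ℝ (FF u i) x (EuclideanSpace.single i 1)
      + 2 * Complex.I * k * ((‖x‖^3)⁻¹ • ww u x) + (‖x‖^3)⁻¹ • fderiv ℝ (bb u) x x := by
  have hp := npos hR hx
  rw [div_FF hR hu hx, fd_bb hR hu hx]
  have h1 : lap u x = - 2 * (Complex.I * k - ((‖x‖⁻¹ : ℝ) : ℂ)) * rad u x + (V x : ℂ) * u x := by
    linear_combination -hpde
  have h2 : ∀ z : ℂ, ((‖z‖^2 : ℝ) : ℂ) = (starRingEnd ℂ) z * z := by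
    intro z; rw [mul_comm, Complex.mul_conj, Complex.normSq_eq_norm_sq]
  have h3 : (gg V u x : ℂ) = qq x * (∑ i, (starRingEnd ℂ) (pd u i x) * pd u i x
      + V x * (conju u x * u x)) := by
    simp only [gg, Complex.ofReal_mul, Complex.ofReal_add, Complex.ofReal_sum, h2, conju]
  have hn : (‖x‖:ℂ) ≠ 0 := by exact_mod_cast hp.ne'
  have hq : (qq x : ℂ) = ((‖x‖:ℂ)^2)⁻¹ := by simp [qq]
  have hw : ww u x = conju u x * fderiv ℝ u x x := rfl
  rw [h3, h1, rad_eq, hw, hq]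
  simp only [Complex.real_smul, Complex.ofReal_inv, Complex.ofReal_pow]
  field_simp
  ring

lemma cont_sph (hR : 0 ≤ R) {s : ℝ} (hs : R < s) {G : Type*} [TopologicalSpace G] {f : E3 → G}
    (hf : ContinuousOn f (ext R)) : Continuous fun ω : sphere (0:E3) 1 => f (s • (ω:E3)) := by
  refine hf.comp_continuous (by fun_prop) fun ω => ?_
  have h0 : 0 < s := hR.trans_lt hs
  have : ‖(ω:E3)‖ = 1 := by simpa using ω.2
  change R < ‖s • (ω:E3)‖
  rw [norm_smul, this, Real.norm_of_nonneg h0.le, mul_one]; exact hs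

lemma cs {X : Type*} [TopologicalSpace X] [CompactSpace X] [MeasurableSpace X] [BorelSpace X]
    (m : Measure X) [IsFiniteMeasure m] {f g : X → ℝ} (hf : Continuous f) (hg : Continuous g)
    (hf0 : ∀ x, 0 ≤ f x) (hg0 : ∀ x, 0 ≤ g x) :
    ∫ x, f x * g x ∂m ≤ Real.sqrt ((∫ x, f x ^ 2 ∂m) * ∫ x, g x ^ 2 ∂m) := by
  have hL : ∀ f : X → ℝ, Continuous f → MemLp f (ENNReal.ofReal 2) m := by
    intro f hf
    exact hf.memLp_of_hasCompactSupport (HasCompactSupport.of_compactSpace f)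
  have h := integral_mul_le_Lp_mul_Lq_of_nonneg (μ := m) (p := 2) (q := 2)
    (by rw [Real.holderConjugate_iff]; norm_num)
    (ae_of_all _ hf0) (ae_of_all _ hg0) (hL f hf) (hL g hg)
  rw [Real.sqrt_mul (integral_nonneg fun x => by positivity), Real.sqrt_eq_rpow, Real.sqrt_eq_rpow]
  simpa using h

lemma contfd {G : Type*} [NormedAddCommGroup G] [NormedSpace ℝ G] {f : E3 → G}
    (hf : ContDiffOn ℝ 1 f (ext R)) : ContinuousOn (fderiv ℝ f) (ext R) :=
  (hf.continuousOn_fderiv_of_isOpen (ext_open R) le_rfl)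

lemma cont_n3 (hR : 0 ≤ R) : ContinuousOn (fun x : E3 => (‖x‖^3)⁻¹) (ext R) := by
  refine ContinuousOn.inv₀ (by fun_prop) ?_
  intro x hx
  have := npos hR hx
  positivity

lemma int_V {r : ℝ} (ρ : ℝ) (hr : R < r) (hV : Measurable V) (hV0 : ∀ x, 0 ≤ V x)
    {B : ℝ} (hB : ∀ x, V x ≤ B) {f : E3 → ℝ} (hf : ContinuousOn f (ext R)) :
    IntegrableOn (fun x => V x * f x) (ann r ρ) := by
  refine Integrable.bdd_mul (c := B) (intOn_ann ρ hr f hf) hV.aestronglyMeasurable (ae_of_all _ ?_)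
  intro x
  rw [Real.norm_of_nonneg (hV0 x)]; exact hB x

lemma ident (hR : 0 ≤ R) (hu : ContDiffOn ℝ 2 u (ext R))
    (hpde : ∀ x ∈ ext R, -(lap u x) - 2 * (Complex.I * k - ((‖x‖⁻¹ : ℝ) : ℂ)) * rad u x
                  + (V x : ℂ) * u x = 0) {r ρ : ℝ} (hr : R < r) (hρ : r < ρ) :
    ((∫ x in ann r ρ, gg V u x : ℝ) : ℂ) =
      2 * Complex.I * k * (∫ x in ann r ρ, (‖x‖^3)⁻¹ • ww u x)
      + ∫ ω, (bb u (ρ • (ω:E3)) - bb u (r • (ω:E3))) ∂sg := by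
  rw [← integral_complex_ofReal]
  have e : ∫ x in ann r ρ, ((gg V u x : ℝ) : ℂ) = ∫ x in ann r ρ,
      (∑ i, fderiv ℝ (FF u i) x (EuclideanSpace.single i 1)
      + 2 * Complex.I * k * ((‖x‖^3)⁻¹ • ww u x) + (‖x‖^3)⁻¹ • fderiv ℝ (bb u) x x) := by
    refine setIntegral_congr_fun (ann_meas r ρ) fun x hx => ?_
    have hx' : x ∈ ext R := hr.trans hx.1
    exact pointwise hR hu hx' (hpde x hx')
  have i1 : IntegrableOn (fun x => ∑ i, fderiv ℝ (FF u i) x (EuclideanSpace.single i 1)) (ann r ρ) := by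
    refine intOn_ann ρ hr _ ?_
    refine continuousOn_finsetSum _ fun i _ => ?_
    exact (contfd (cd_FF hR hu i)).clm_apply continuousOn_const
  have i2 : IntegrableOn (fun x => 2 * Complex.I * k * ((‖x‖^3)⁻¹ • ww u x)) (ann r ρ) := by
    refine intOn_ann ρ hr _ ?_
    exact continuousOn_const.mul ((cont_n3 hR).smul (cd_ww hu).continuousOn)
  have i3 : IntegrableOn (fun x => (‖x‖^3)⁻¹ • fderiv ℝ (bb u) x x) (ann r ρ) := by
    refine intOn_ann ρ hr _ ?_
    exact (cont_n3 hR).smul ((contfd (cd_bb hR hu)).clm_apply continuousOn_id)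
  have i12 : IntegrableOn (fun x => ∑ i, fderiv ℝ (FF u i) x (EuclideanSpace.single i 1)
      + 2 * Complex.I * k * ((‖x‖^3)⁻¹ • ww u x)) (ann r ρ) := i1.add i2
  rw [e, integral_add i12 i3, integral_add i1 i2, integral_const_mul,
    lemT (FF u) hR hr hρ (cd_FF hR hu) (tang hR), lemP (bb u) hR hr hρ (cd_bb hR hu), zero_add]

lemma identM (hR : 0 ≤ R) (hu : ContDiffOn ℝ 2 u (ext R)) {r ρ : ℝ} (hr : R < r) (hρ : r < ρ) :
    2 * (∫ x in ann r ρ, (‖x‖^3)⁻¹ • ww u x).re =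
      (∫ ω, ‖u (ρ • (ω:E3))‖^2 ∂sg) - ∫ ω, ‖u (r • (ω:E3))‖^2 ∂sg := by
  have i2 : IntegrableOn (fun x => ((‖x‖^3)⁻¹ • ww u x)) (ann r ρ) := 
    intOn_ann ρ hr _ ((cont_n3 hR).smul (cd_ww hu).continuousOn)
  have h1 : (∫ x in ann r ρ, (‖x‖^3)⁻¹ • ww u x).re = ∫ x in ann r ρ, ((‖x‖^3)⁻¹ • ww u x).re :=
    (Complex.reCLM.integral_comp_comm i2).symm
  have cn : ContinuousOn (fun x => ‖u x‖^2) (ext R) := (hu.continuousOn.norm).pow 2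
  have is : ∀ s, R < s → Integrable (fun ω : sphere (0:E3) 1 => ‖u (s • (ω:E3))‖^2) sg := fun s hs =>
    (cont_sph hR hs cn).integrable_of_hasCompactSupport (HasCompactSupport.of_compactSpace _)
  rw [h1, ← integral_const_mul, ← integral_sub (is ρ (hr.trans hρ)) (is r hr),
    ← lemP (fun x => ‖u x‖^2) hR hr hρ ((cd_u1 hu).norm_sq ℝ)]
  refine setIntegral_congr_fun (ann_meas r ρ) fun x hx => ?_
  have hx' : x ∈ ext R := hr.trans hx.1
  simp only [fd_nsq hu hx']
  rw [Complex.smul_re, smul_eq_mul, smul_eq_mul]; ring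

lemma energy (hR : 0 ≤ R) (hu : ContDiffOn ℝ 2 u (ext R)) 
    (hpde : ∀ x ∈ ext R, -(lap u x) - 2 * (Complex.I * k - ((‖x‖⁻¹ : ℝ) : ℂ)) * rad u x
                  + (V x : ℂ) * u x = 0) {r ρ : ℝ} (hr : R < r) (hρ : r < ρ) :
    k.im * (∫ x in ann r ρ, gg V u x) ≤ ‖k‖^2 * (∫ ω, ‖u (r • (ω:E3))‖^2 ∂sg)
      + ‖k‖ * (‖∫ ω, bb u (ρ • (ω:E3)) ∂sg‖ + ‖∫ ω, bb u (r • (ω:E3)) ∂sg‖) := by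
  have h1 := ident hR hu hpde hr hρ
  have h2 := identM hR hu hr hρ
  have is : ∀ s, R < s → Integrable (fun ω : sphere (0:E3) 1 => bb u (s • (ω:E3))) sg := fun s hs =>
    (cont_sph hR hs (cd_bb hR hu).continuousOn).integrable_of_hasCompactSupport (HasCompactSupport.of_compactSpace _)
  rw [integral_sub (is ρ (hr.trans hρ)) (is r hr)] at h1
  have h3 : 0 ≤ ∫ ω, ‖u (ρ • (ω:E3))‖^2 ∂sg := integral_nonneg fun _ => by positivity
  generalize (∫ x in ann r ρ, gg V u x) = E at *
  generalize (∫ ω, ‖u (r • (ω:E3))‖^2 ∂sg) = M at *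
  generalize (∫ ω, ‖u (ρ • (ω:E3))‖^2 ∂sg) = M' at *
  generalize (∫ ω, bb u (ρ • (ω:E3)) ∂sg) = b' at *
  generalize (∫ ω, bb u (r • (ω:E3)) ∂sg) = b at *
  generalize (∫ x in ann r ρ, (‖x‖^3)⁻¹ • ww u x) = A at *
  have h4 : Complex.I * (starRingEnd ℂ) k * (E:ℂ) =
      - 2 * ((‖k‖^2:ℝ):ℂ) * A + Complex.I * (starRingEnd ℂ) k * (b' - b) := by
    rw [h1, ← Complex.normSq_eq_norm_sq, ← Complex.mul_conj]
    linear_combination (2 * k * (starRingEnd ℂ) k * A) * Complex.I_mul_I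
  have h5 := congrArg Complex.re h4
  have h6 : (Complex.I * (starRingEnd ℂ) k * (E:ℂ)).re = k.im * E := by simp
  have h7 : (- 2 * ((‖k‖^2:ℝ):ℂ) * A).re = - ‖k‖^2 * (2 * A.re) := by
    have : (- 2 * ((‖k‖^2:ℝ):ℂ) * A) = ((-2 * ‖k‖^2 : ℝ) : ℂ) * A := by push_cast; ring
    rw [this, Complex.re_ofReal_mul]; ring
  have h8 : (Complex.I * (starRingEnd ℂ) k * (b' - b)).re ≤ ‖k‖ * (‖b'‖ + ‖b‖) := by
    refine (Complex.re_le_norm _).trans ?_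
    rw [norm_mul, norm_mul, Complex.norm_I, one_mul, RCLike.norm_conj]
    gcongr
    exact norm_sub_le _ _
  rw [h6, Complex.add_re, h7, h2] at h5
  rw [h5]
  nlinarith [mul_nonneg (sq_nonneg ‖k‖) h3]

lemma bnd_b (hR : 0 ≤ R) (hu : ContDiffOn ℝ 2 u (ext R)) {r : ℝ} (hr : R < r) :
    ‖∫ ω, bb u (r • (ω:E3)) ∂sg‖ ≤
      Real.sqrt ((∫ ω, ‖u (r • (ω:E3))‖^2 ∂sg) * ∫ ω, ‖rad u (r • (ω:E3))‖^2 ∂sg) := by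
  have c1 : ContinuousOn (rad u) (ext R) := by
    have : rad u = fun x => ‖x‖⁻¹ • fderiv ℝ u x x := funext rad_eq
    rw [this]
    exact (cd_ninv hR).continuousOn.smul ((contfd (cd_u1 hu)).clm_apply continuousOn_id)
  refine (norm_integral_le_integral_norm _).trans ?_
  refine le_trans (le_of_eq ?_) (cs sg (cont_sph hR hr hu.continuousOn.norm) (cont_sph hR hr c1.norm)
    (fun _ => norm_nonneg _) (fun _ => norm_nonneg _))
  refine integral_congr_ae (ae_of_all _ fun ω => ?_)
  simp only [bb_eq, norm_mul, conju, RCLike.norm_conj]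

lemma b_lim (hR : 0 ≤ R) {B : ℝ} (hB : ∀ x ∈ ext R, ‖u x‖ ≤ B)
    (ht : Tendsto (fun x : E3 => fderiv ℝ u x) (cocompact E3) (nhds 0)) :
    Tendsto (fun ρ : ℝ => ‖∫ ω, bb u (ρ • (ω:E3)) ∂sg‖) atTop (nhds 0) := by
  rw [Metric.tendsto_nhds]
  intro ε hε
  set T := sg.real Set.univ with hT
  have hT0 : 0 ≤ T := measureReal_nonneg
  set δ := ε / ((|B|+1) * (T+1)) with hδ
  have hδ0 : 0 < δ := by positivity
  have h1 : ∀ᶠ x in cocompact E3, ‖fderiv ℝ u x‖ < δ := by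
    have := (Metric.tendsto_nhds.1 ht) δ hδ0
    simpa using this
  rw [← Metric.cobounded_eq_cocompact, ← comap_norm_atTop, eventually_comap] at h1
  filter_upwards [h1, eventually_gt_atTop R] with ρ h hρR
  have h0 : 0 < ρ := hR.trans_lt hρR
  have hb : ∀ ω : sphere (0:E3) 1, ‖bb u (ρ • (ω:E3))‖ ≤ |B| * δ := by
    intro ω
    have hω : ‖(ω:E3)‖ = 1 := by simpa using ω.2
    have hn : ‖ρ • (ω:E3)‖ = ρ := by rw [norm_smul, hω, Real.norm_of_nonneg h0.le, mul_one]
    have hx : ρ • (ω:E3) ∈ ext R := by change R < _; rw [hn]; exact hρR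
    rw [bb_eq, norm_mul, conju, RCLike.norm_conj]
    have a1 := (hB _ hx).trans (le_abs_self B)
    have a2 : ‖rad u (ρ • (ω:E3))‖ ≤ δ := by
      rw [rad]
      refine (ContinuousLinearMap.le_opNorm _ _).trans ?_
      rw [norm_smul, norm_inv, norm_norm, inv_mul_cancel₀ (by rw [hn]; exact h0.ne'), mul_one]
      exact (h _ hn).le
    gcongr
  have h2 := norm_integral_le_of_norm_le_const (μ := sg) (ae_of_all _ hb)
  rw [Real.dist_eq, sub_zero, abs_norm]
  refine h2.trans_lt ?_
  have : ε = (|B|+1) * (T+1) * δ := by rw [hδ]; field_simp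
  rw [this]
  have := abs_nonneg B
  nlinarith [mul_nonneg this hT0, mul_nonneg (mul_nonneg this hT0) hδ0.le, mul_nonneg hT0 hδ0.le, mul_nonneg this hδ0.le]

lemma lower (hR : 0 ≤ R) (hu : ContDiffOn ℝ 2 u (ext R)) (hV : Measurable V) (hV0 : ∀ x, 0 ≤ V x)
    {B : ℝ} (hB : ∀ x, V x ≤ B) {r ρ : ℝ} (hr : R < r) :
    IntegrableOn (fun x => ‖fderiv ℝ u x‖ ^ 2 / ‖x‖ ^ 2) (ann r ρ) ∧
    IntegrableOn (fun x => V x * ‖u x‖ ^ 2 / ‖x‖ ^ 2) (ann r ρ) ∧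
    (∫ x in ann r ρ, ‖fderiv ℝ u x‖ ^ 2 / ‖x‖ ^ 2) + (∫ x in ann r ρ, V x * ‖u x‖ ^ 2 / ‖x‖ ^ 2)
      ≤ ∫ x in ann r ρ, gg V u x := by
  have hq : ContinuousOn qq (ext R) := (cd_qq hR).continuousOn
  have i1 : IntegrableOn (fun x => ‖fderiv ℝ u x‖ ^ 2 / ‖x‖ ^ 2) (ann r ρ) := by
    refine intOn_ann ρ hr _ ?_
    simp only [div_eq_mul_inv]
    exact ((contfd (cd_u1 hu)).norm.pow 2).mul hq
  have i2 : IntegrableOn (fun x => V x * ‖u x‖ ^ 2 / ‖x‖ ^ 2) (ann r ρ) := by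
    simp only [mul_div_assoc]
    refine int_V ρ hr hV hV0 hB ?_
    simp only [div_eq_mul_inv]
    exact (hu.continuousOn.norm.pow 2).mul hq
  have i3 : IntegrableOn (fun x => qq x * ∑ i, ‖pd u i x‖^2) (ann r ρ) := by
    refine intOn_ann ρ hr _ ?_
    refine hq.mul (continuousOn_finsetSum _ fun i _ => ?_)
    exact (cd_pd hu i).continuousOn.norm.pow 2
  refine ⟨i1, i2, ?_⟩
  rw [← integral_add i1 i2]
  have e : ∀ x, gg V u x = qq x * (∑ i, ‖pd u i x‖^2) + V x * ‖u x‖ ^ 2 / ‖x‖ ^ 2 := by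
    intro x; simp only [gg, qq]; ring
  simp only [e]
  refine integral_mono (i1.add i2) (i3.add i2) fun x => ?_
  have := opn (fderiv ℝ u x)
  have hq0 : 0 ≤ qq x := by unfold qq; positivity
  change ‖fderiv ℝ u x‖ ^ 2 / ‖x‖ ^ 2 + _ ≤ qq x * (∑ i, ‖pd u i x‖^2) + _
  have e2 : ‖fderiv ℝ u x‖ ^ 2 / ‖x‖ ^ 2 = qq x * ‖fderiv ℝ u x‖^2 := by unfold qq; ring
  rw [e2]
  gcongr
  exact this

lemma pass {f1 f2 : E3 → ℝ} {r : ℝ} (h1 : ∀ x, 0 ≤ f1 x) (h2 : ∀ x, 0 ≤ f2 x)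
    (i1 : ∀ ρ, IntegrableOn f1 (ann r ρ)) (i2 : ∀ ρ, IntegrableOn f2 (ann r ρ))
    {b : ℝ → ℝ} {L : ℝ} (hb : Tendsto b atTop (nhds L))
    (h : ∀ ρ, r < ρ → (∫ x in ann r ρ, f1 x) + (∫ x in ann r ρ, f2 x) ≤ b ρ) :
    (∫ x in ext r, f1 x) + (∫ x in ext r, f2 x) ≤ L := by
  have hc : AECover (volume.restrict (ext r)) (atTop : Filter ℝ) (fun ρ => ball (0:E3) ρ) :=
    (aecover_ball tendsto_id).restrict
  have hs : ∀ ρ, (volume.restrict (ext r)).restrict (ball (0:E3) ρ) = volume.restrict (ann r ρ) := by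
    intro ρ
    rw [Measure.restrict_restrict isOpen_ball.measurableSet]
    congr 1
    ext x
    simp [ann, ext, and_comm]
  have hI : ∀ (f g : E3 → ℝ), (∀ x, 0 ≤ f x) → (∀ x, 0 ≤ g x) → (∀ ρ, IntegrableOn f (ann r ρ)) →
      (∀ ρ, r < ρ → (∫ x in ann r ρ, f x) + (∫ x in ann r ρ, g x) ≤ b ρ) →
      Integrable f (volume.restrict (ext r)) := by
    intro f g hf hg i hfg
    refine hc.integrable_of_integral_bounded_of_nonneg_ae (L+1) (fun ρ => ?_) (ae_of_all _ hf) ?_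
    · rw [IntegrableOn, hs]; exact i ρ
    · filter_upwards [hb.eventually (ge_mem_nhds (lt_add_one L)), eventually_gt_atTop r] with ρ hρ hρr
      rw [hs]
      have := hfg ρ hρr
      have : 0 ≤ ∫ x in ann r ρ, g x := integral_nonneg hg
      linarith
  have t1 := hc.integral_tendsto_of_countably_generated (hI f1 f2 h1 h2 i1 h)
  have t2 := hc.integral_tendsto_of_countably_generated (hI f2 f1 h2 h1 i2
    (fun ρ hρ => by rw [add_comm]; exact h ρ hρ))
  refine le_of_tendsto_of_tendsto (t1.add t2) hb ?_
  filter_upwards [eventually_gt_atTop r] with ρ hρ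
  simp only [hs]
  exact h ρ hρ

end

lemma main_bound (k : ℂ) (hk : 0 < k.im) (R : ℝ) (hR : 0 ≤ R) (V : E3 → ℝ) (hV : Measurable V)
    (hV0 : ∀ x, 0 ≤ V x) (hVB : ∃ B : ℝ, ∀ x, V x ≤ B) (u : E3 → ℂ) (hu : ContDiffOn ℝ 2 u (ext R))
    (hub : ∃ B : ℝ, ∀ x : E3, R < ‖x‖ → ‖u x‖ ≤ B)
    (hpde : ∀ x : E3, R < ‖x‖ → -(lap u x) - 2 * (Complex.I * k - ((‖x‖⁻¹ : ℝ) : ℂ)) * rad u x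
                  + (V x : ℂ) * u x = 0)
    (ht : Tendsto (fun x : E3 => fderiv ℝ u x) (cocompact E3) (nhds 0)) (r : ℝ) (hr : R < r) :
    (∫ x in ext r, ‖fderiv ℝ u x‖ ^ 2 / ‖x‖ ^ 2) + (∫ x in ext r, V x * ‖u x‖ ^ 2 / ‖x‖ ^ 2) ≤
      KS.toReal * (‖k‖ ^ 2 / k.im) * (sphAvg u r + ‖k‖⁻¹ * Real.sqrt (sphAvg u r * sphAvg1 u r)) := by
  obtain ⟨B, hB⟩ := hVB
  obtain ⟨B', hB'⟩ := hub
  have h0 : 0 < r := hR.trans_lt hr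
  have hkn : 0 < ‖k‖ := hk.trans_le ((le_abs_self _).trans (Complex.abs_im_le_norm k))
  set M := ∫ ω, ‖u (r • (ω:E3))‖^2 ∂sg with hM
  set M1 := ∫ ω, ‖rad u (r • (ω:E3))‖^2 ∂sg with hM1
  have hM0 : 0 ≤ M := integral_nonneg fun _ => by positivity
  have hM10 : 0 ≤ M1 := integral_nonneg fun _ => by positivity
  have hb := bnd_b hR hu hr
  have hlim := b_lim hR hB' ht
  have key := pass (r := r) (f1 := fun x => ‖fderiv ℝ u x‖ ^ 2 / ‖x‖ ^ 2)
    (f2 := fun x => V x * ‖u x‖ ^ 2 / ‖x‖ ^ 2) (fun x => by positivity)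
    (fun x => by have := hV0 x; positivity)
    (fun ρ => (lower hR hu hV hV0 hB hr (ρ := ρ)).1) (fun ρ => (lower hR hu hV hV0 hB hr (ρ := ρ)).2.1)
    (b := fun ρ => (‖k‖^2 * M + ‖k‖ * (‖∫ ω, bb u (ρ • (ω:E3)) ∂sg‖ + ‖∫ ω, bb u (r • (ω:E3)) ∂sg‖)) / k.im)
    (L := (‖k‖^2 * M + ‖k‖ * (0 + ‖∫ ω, bb u (r • (ω:E3)) ∂sg‖)) / k.im)
    (((hlim.add_const _).const_mul _).const_add _ |>.div_const _)
    (fun ρ hρ => by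
      refine (lower hR hu hV hV0 hB hr (ρ := ρ)).2.2.trans ?_
      rw [le_div_iff₀ hk, mul_comm]
      exact energy hR hu hpde hr hρ)
  refine key.trans ?_
  have hsub : sphere (0:E3) r ⊆ ext R := by
    intro x hx
    rw [mem_sphere_zero_iff_norm] at hx
    change R < ‖x‖; rw [hx]; exact hr
  have c1 : ContinuousOn (rad u) (ext R) := by
    have : rad u = fun x => ‖x‖⁻¹ • fderiv ℝ u x x := funext rad_eq
    rw [this]
    exact (cd_ninv hR).continuousOn.smul ((contfd (cd_u1 hu)).clm_apply continuousOn_id)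
  have s1 : M ≤ KS.toReal * sphAvg u r := sph_le r h0 (fun x => ‖u x‖^2)
    ((hu.continuousOn.norm.pow 2).mono hsub) (fun x => by positivity)
  have s2 : M1 ≤ KS.toReal * sphAvg1 u r := sph_le r h0 (fun x => ‖rad u x‖^2)
    ((c1.norm.pow 2).mono hsub) (fun x => by positivity)
  have hK : 0 ≤ KS.toReal := ENNReal.toReal_nonneg
  have s3 : Real.sqrt (M * M1) ≤ KS.toReal * Real.sqrt (sphAvg u r * sphAvg1 u r) := by
    have : M * M1 ≤ KS.toReal^2 * (sphAvg u r * sphAvg1 u r) :=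
      (mul_le_mul s1 s2 hM10 (hM0.trans s1)).trans (le_of_eq (by ring))
    refine (Real.sqrt_le_sqrt this).trans (le_of_eq ?_)
    rw [Real.sqrt_mul (sq_nonneg _), Real.sqrt_sq hK]
  have s4 := hb.trans s3
  have e : KS.toReal * (‖k‖ ^ 2 / k.im) * (sphAvg u r + ‖k‖⁻¹ * Real.sqrt (sphAvg u r * sphAvg1 u r))
    = (‖k‖^2 * (KS.toReal * sphAvg u r)
      + ‖k‖ * (0 + KS.toReal * Real.sqrt (sphAvg u r * sphAvg1 u r))) / k.im := by
    field_simp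
    ring
  rw [e]
  gcongr

/-- For `k ∈ ℂ⁺`, `R ≥ 0`, `V ∈ L∞` with `V ≥ 0`, and a bounded `C²`
solution `μ` of `−Δμ − 2(ik − 1/|x|)∂_rμ + Vμ = 0` on `{|x| > R}` with `∇μ → 0` at infinity,
one has for every `r > R`:
`∫_{|x|>r} |∇μ|²/|x|² + ∫_{|x|>r} V|μ|²/|x|² ≤ C (|k|²/Im k)(m(r) + |k|⁻¹ √(m(r) m₁(r)))`. -/
theorem stmt_13 :
    ∃ C : ℝ, 0 < C ∧
      ∀ k : ℂ, 0 < k.im →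
        ∀ R : ℝ, 0 ≤ R →
          ∀ V : EuclideanSpace ℝ (Fin 3) → ℝ, Measurable V →
            (∀ x, 0 ≤ V x) → (∃ B : ℝ, ∀ x, V x ≤ B) →
            ∀ μ : EuclideanSpace ℝ (Fin 3) → ℂ,
              ContDiffOn ℝ 2 μ {x : EuclideanSpace ℝ (Fin 3) | R < ‖x‖} →
              (∃ B : ℝ, ∀ x : EuclideanSpace ℝ (Fin 3), R < ‖x‖ → ‖μ x‖ ≤ B) →
              (∀ x : EuclideanSpace ℝ (Fin 3), R < ‖x‖ →
                -(lap μ x) - 2 * (Complex.I * k - ((‖x‖⁻¹ : ℝ) : ℂ)) * rad μ x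
                  + (V x : ℂ) * μ x = 0) →
              Tendsto (fun x : EuclideanSpace ℝ (Fin 3) => fderiv ℝ μ x)
                (cocompact (EuclideanSpace ℝ (Fin 3))) (nhds 0) →
              ∀ r : ℝ, R < r →
                (∫ x in {x : EuclideanSpace ℝ (Fin 3) | r < ‖x‖},
                    ‖fderiv ℝ μ x‖ ^ 2 / ‖x‖ ^ 2)
                  + (∫ x in {x : EuclideanSpace ℝ (Fin 3) | r < ‖x‖},
                    V x * ‖μ x‖ ^ 2 / ‖x‖ ^ 2) ≤
                  C * (‖k‖ ^ 2 / k.im) *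
                    (sphAvg μ r + ‖k‖⁻¹ * Real.sqrt (sphAvg μ r * sphAvg1 μ r)) := by
  refine ⟨KS.toReal, ENNReal.toReal_pos KS_pos KS_top, ?_⟩
  intro k hk R hR V hV hV0 hVB μ hu hub hpde ht r hr
  exact main_bound k hk R hR V hV hV0 hVB μ hu hub hpde ht r hr
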